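/- Let n ≥ 3 be a natural number, let p be a prime, and let s be the p-adic valuation of n!. Let d, k be integers with d ≠ k, and let t be the p-adic valuation of d − k. Suppose that for every r with 2 ≤ r ≤ n, p^(s·(r−1)) divides (d − k)^(r−1)·(d + (r−1)·k). If t < s, then s ≥ n − 1 (so that p^(n−1) divides n!, and hence p = 2 and n is a power of 2). -/

import Mathlib

open Nat

lemma digsum_pos (n : ℕ) : 0 < n → 1 ≤ (Nat.digits 2 n).sum := by
  induction n using Nat.strong_induction_on with
  | _ n ih =>
    intro hn
    rw [Nat.digits_def' (by norm_num) hn, List.sum_cons]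
    by_cases h : n / 2 = 0
    · omega
    · have := ih (n / 2) (by omega) (by omega)
      omega

lemma digsum_le_one (n : ℕ) : 0 < n → (Nat.digits 2 n).sum ≤ 1 → ∃ j : ℕ, n = 2 ^ j := by
  induction n using Nat.strong_induction_on with
  | _ n ih =>
    intro hn hs
    rw [Nat.digits_def' (by norm_num) hn, List.sum_cons] at hs
    by_cases h : n / 2 = 0
    · exact ⟨0, by simp; omega⟩
    · have h1 := digsum_pos (n / 2) (by omega)
      obtain ⟨j, hj⟩ := ih (n / 2) (by omega) (by omega) (by omega)
      exact ⟨j + 1, by rw [pow_succ, ← hj]; omega⟩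

/-- The `p`-adic step in the proof of Lemma 15: with `s` the `p`-adic valuation
of `n!`, `t` the `p`-adic valuation of `d - k ≠ 0`, and the divisibilities
`p^(s(r-1)) ∣ (d-k)^(r-1)·(d + (r-1)k)` for `2 ≤ r ≤ n`, if `t < s` then
`s ≥ n - 1`, so `p^(n-1) ∣ n!`, hence `p = 2` and `n` is a power of `2`. -/
theorem padic_step (n : ℕ) (hn : 3 ≤ n) (p : ℕ) (hp : p.Prime)
    (s : ℕ) (hs : s = padicValNat p (n !))
    (d k : ℤ) (hdk : d ≠ k)
    (t : ℕ) (ht : t = padicValInt p (d - k))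
    (h : ∀ r : ℕ, 2 ≤ r → r ≤ n →
      (p : ℤ) ^ (s * (r - 1)) ∣ (d - k) ^ (r - 1) * (d + ((r : ℤ) - 1) * k))
    (hts : t < s) :
    n - 1 ≤ s ∧ p ^ (n - 1) ∣ n ! ∧ p = 2 ∧ ∃ j : ℕ, n = 2 ^ j := by
  haveI : Fact p.Prime := ⟨hp⟩
  have hne : d - k ≠ 0 := sub_ne_zero.mpr hdk
  have hpp : Prime (p : ℤ) := Nat.prime_iff_prime_int.mp hp
  have hval : ∀ m : ℕ, (p : ℤ) ^ m ∣ d - k ↔ m ≤ t := by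
    intro m
    rw [padicValInt_dvd_iff, ht]
    simp [hne]
  obtain ⟨u, hu⟩ := (hval t).2 le_rfl
  have hpu : ¬ (p : ℤ) ∣ u := by
    rintro ⟨v, hv⟩
    have : t + 1 ≤ t := (hval (t + 1)).1 ⟨v, by rw [hu, hv]; ring⟩
    omega
  obtain ⟨a, rfl⟩ : ∃ a, s = t + a := ⟨s - t, by omega⟩
  have key : ∀ r : ℕ, 2 ≤ r → r ≤ n → (p : ℤ) ^ (a * (r - 1)) ∣ d + ((r : ℤ) - 1) * k := by
    intro r h2 hr
    have h1 := h r h2 hr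
    rw [hu, mul_pow, add_mul, pow_add, ← pow_mul, mul_assoc] at h1
    have h3 := (mul_dvd_mul_iff_left (pow_ne_zero _ hpp.ne_zero)).1 h1
    exact hpp.pow_dvd_of_dvd_mul_left _ (fun hc => hpu (hpp.dvd_of_dvd_pow hc)) h3
  have k1 := key (n - 1) (by omega) (by omega)
  have k2 := (pow_dvd_pow (p : ℤ) (show a * (n - 1 - 1) ≤ a * (n - 1) from
    Nat.mul_le_mul_left _ (by omega))).trans (key n (by omega) le_rfl)
  rw [Nat.cast_sub (by omega)] at k1
  have hk : (p : ℤ) ^ (a * (n - 1 - 1)) ∣ k := by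
    have := dvd_sub k2 k1
    have e : d + ((n : ℤ) - 1) * k - (d + (((n : ℤ) - ((1 : ℕ) : ℤ)) - 1) * k) = k := by
      push_cast
      ring
    rwa [e] at this
  have hdk2 : (p : ℤ) ^ (a * (n - 1 - 1)) ∣ d - k := by
    have := dvd_sub k2 (hk.mul_left (n : ℤ))
    have e : d + ((n : ℤ) - 1) * k - (n : ℤ) * k = d - k := by ring
    rwa [e] at this
  have hle := (hval _).1 hdk2
  have hle2 : 1 * (n - 1 - 1) ≤ a * (n - 1 - 1) := Nat.mul_le_mul_right _ (by omega)
  have hS : n - 1 ≤ t + a := by omega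
  have hlt := sub_one_mul_padicValNat_factorial_lt_of_ne_zero p (n := n) (by omega)
  have hleg := sub_one_mul_padicValNat_factorial (p := p) n
  rw [← hs] at hlt hleg
  have hp2 : p = 2 := by
    by_contra hne2
    have := hp.two_le
    have : 2 * (t + a) ≤ (p - 1) * (t + a) := Nat.mul_le_mul_right _ (by omega)
    omega
  refine ⟨hS, ?_, hp2, ?_⟩
  · rw [padicValNat_dvd_iff_le (Nat.factorial_ne_zero n), ← hs]
    exact hS
  · subst hp2
    exact digsum_le_one n (by omega) (by omega)
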